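/- arXiv:1907.07078 — 10 statements merged into one kernel-verified Lean document; each statement's English description precedes it below -/
import Mathlib

section
/- In synchronous flooding on a connected finite simple graph with initial node g0, every node of the graph belongs to at most two distinct round-sets; that is, for every node g there are at most two indices i with g ∈ R_i. -/
/-- `ReachableIn G a n v`: there is a walk of length exactly `n` from `a` to `v`. -/
def ReachableIn {V : Type*} (G : SimpleGraph V) (a : V) : ℕ → V → Prop
  | 0, v => v = a
  | n + 1, v => ∃ u, ReachableIn G a n u ∧ G.Adj u v

/-- `n` is the least length of a walk from `a` to `v` among the walk lengths of the parity of `n`;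
equivalently, `n` is the distance from `(a, 0)` to `(v, n % 2)` in the bipartite double cover. -/
def IsParityDist {V : Type*} (G : SimpleGraph V) (a : V) (n : ℕ) (v : V) : Prop :=
  ReachableIn G a n v ∧ ∀ j, ReachableIn G a j v → j % 2 = n % 2 → n ≤ j

theorem IsParityDist.eq {V : Type*} {G : SimpleGraph V} {a v : V} {m n : ℕ}
    (hm : IsParityDist G a m v) (hn : IsParityDist G a n v) (h : m % 2 = n % 2) : m = n :=
  le_antisymm (hm.2 n hn.1 h.symm) (hn.2 m hm.1 h)

theorem isParityDist_zero {V : Type*} {G : SimpleGraph V} {a v : V} :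
    IsParityDist G a 0 v ↔ v = a :=
  ⟨fun h => h.1, fun h => ⟨h, fun _ _ _ => Nat.zero_le _⟩⟩

theorem isParityDist_one {V : Type*} {G : SimpleGraph V} {a v : V} :
    IsParityDist G a 1 v ↔ G.Adj a v := by
  constructor
  · rintro ⟨⟨u, hu, huv⟩, -⟩
    obtain rfl : u = a := hu
    exact huv
  · exact fun h => ⟨⟨a, rfl, h⟩, fun j _ hj => by omega⟩

theorem IsParityDist.exists_pred {V : Type*} {G : SimpleGraph V} {a v : V} {n : ℕ}
    (h : IsParityDist G a (n + 1) v) : ∃ u, G.Adj u v ∧ IsParityDist G a n u := by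
  obtain ⟨⟨u, hu, huv⟩, hmin⟩ := h
  refine ⟨u, huv, hu, fun j hj hjn => ?_⟩
  have := hmin (j + 1) ⟨u, hj, huv⟩ (by omega)
  omega

theorem IsParityDist.succ_iff_of_adj {V : Type*} {G : SimpleGraph V} {a u v : V} {n : ℕ}
    (hu : IsParityDist G a (n + 1) u) (huv : G.Adj u v) :
    IsParityDist G a (n + 2) v ↔ ¬ IsParityDist G a n v := by
  constructor
  · intro h h'
    have := h.eq h' (by omega)
    omega
  · refine fun h => ⟨⟨u, hu.1, huv⟩, fun j hj hjn => ?_⟩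
    by_contra! hlt
    have hle := hu.2 (j + 1) ⟨v, hj, huv.symm⟩ (by omega)
    obtain rfl : j = n := by omega
    refine h ⟨hj, fun k hk hkn => ?_⟩
    have := hu.2 (k + 1) ⟨v, hk, huv.symm⟩ (by omega)
    omega

theorem mem_flooding_messages_iff {V : Type*} (G : SimpleGraph V) (a : V) (M : ℕ → Set (V × V))
    (hM1 : M 1 = {p : V × V | p.1 = a ∧ G.Adj a p.2})
    (hMsucc : ∀ i ≥ 1, M (i + 1) =
      {p : V × V | G.Adj p.1 p.2 ∧ (∃ f, (f, p.1) ∈ M i) ∧ (p.2, p.1) ∉ M i})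
    (n : ℕ) (u v : V) :
    (u, v) ∈ M (n + 1) ↔ G.Adj u v ∧ IsParityDist G a n u ∧ IsParityDist G a (n + 1) v := by
  induction n generalizing u v with
  | zero =>
    rw [hM1, isParityDist_zero, isParityDist_one]
    constructor
    · rintro ⟨h, h'⟩
      obtain rfl : u = a := h
      exact ⟨h', rfl, h'⟩
    · rintro ⟨-, h, h'⟩
      exact ⟨h, h'⟩
  | succ n ih =>
    rw [hMsucc (n + 1) (by omega)]
    simp only [Set.mem_ofPred_eq, ih]
    constructor
    · rintro ⟨huv, ⟨f, -, -, hu⟩, hn⟩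
      exact ⟨huv, hu, (hu.succ_iff_of_adj huv).2 fun h => hn ⟨huv.symm, h, hu⟩⟩
    · rintro ⟨huv, hu, hv⟩
      obtain ⟨f, hf, hfn⟩ := hu.exists_pred
      exact ⟨huv, ⟨f, hf, hfn, hu⟩, fun h => (hu.succ_iff_of_adj huv).1 hv h.2.1⟩

theorem stmt0 {V : Type*} [Fintype V] (G : SimpleGraph V)
    (hconn : G.Connected) (g0 : V)
    (M : ℕ → Set (V × V)) (R : ℕ → Set V)
    (hM1 : M 1 = {p : V × V | p.1 = g0 ∧ G.Adj g0 p.2})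
    (hMsucc : ∀ i ≥ 1, M (i + 1) =
      {p : V × V | G.Adj p.1 p.2 ∧ (∃ f, (f, p.1) ∈ M i) ∧ (p.2, p.1) ∉ M i})
    (hR0 : R 0 = {g0})
    (hRi : ∀ i ≥ 1, R i = {h : V | ∃ g, (g, h) ∈ M i}) :
    ∀ g : V, ({i : ℕ | g ∈ R i}).encard ≤ 2 := by
  intro g
  have hdist : ∀ i, g ∈ R i → IsParityDist G g0 i g := by
    rintro (_ | i) hi
    · rw [hR0] at hi
      exact isParityDist_zero.2 hi
    · rw [hRi (i + 1) (by omega)] at hi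
      obtain ⟨f, hf⟩ := hi
      exact ((mem_flooding_messages_iff G g0 M hM1 hMsucc i f g).1 hf).2.2
  have hinj : Set.InjOn (· % 2) {i : ℕ | g ∈ R i} :=
    fun i hi j hj h => (hdist i hi).eq (hdist j hj) h
  have hmaps : Set.MapsTo (· % 2) {i : ℕ | g ∈ R i} ({0, 1} : Set ℕ) :=
    fun i _ => Nat.mod_two_eq_zero_or_one i
  exact (Set.encard_le_encard_of_injOn hmaps hinj).trans (Set.encard_pair zero_ne_one).le
end

section
/- In synchronous flooding on a connected finite simple graph with initial node g0, if a node g belongs to two distinct round-sets R_i and R_j with i < j, then j − i is odd. -/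
theorem stmt1 {V : Type*} [Fintype V] (G : SimpleGraph V)
    (hconn : G.Connected) (g0 : V)
    (M : ℕ → Set (V × V)) (R : ℕ → Set V)
    (hM1 : M 1 = {p : V × V | p.1 = g0 ∧ G.Adj g0 p.2})
    (hMsucc : ∀ i ≥ 1, M (i + 1) =
      {p : V × V | G.Adj p.1 p.2 ∧ (∃ f, (f, p.1) ∈ M i) ∧ (p.2, p.1) ∉ M i})
    (hR0 : R 0 = {g0})
    (hRi : ∀ i ≥ 1, R i = {h : V | ∃ g, (g, h) ∈ M i})
    (g : V) (i j : ℕ) (hij : i < j) (hi : g ∈ R i) (hj : g ∈ R j) :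
    Odd (j - i) := by
  have receiver_mem : ∀ n a b, (a, b) ∈ M (n + 1) → b ∈ R (n + 1) := by
    intro n a b hab
    rw [hRi (n + 1) (by omega)]
    exact ⟨a, hab⟩
  have sender_mem : ∀ n a b, (a, b) ∈ M (n + 1) → a ∈ R n ∧ G.Adj a b := by
    intro n a b hab
    rcases n with _ | n
    · rw [zero_add, hM1] at hab
      obtain ⟨rfl, hadj⟩ := hab
      exact ⟨by simp [hR0], hadj⟩
    · rw [hMsucc (n + 1) (by omega)] at hab
      rw [hRi (n + 1) (by omega)]
      exact ⟨hab.2.1, hab.1⟩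
  have send_or_received : ∀ n a b, a ∈ R n → G.Adj a b →
      (a, b) ∈ M (n + 1) ∨ (1 ≤ n ∧ (b, a) ∈ M n) := by
    intro n a b ha hadj
    rcases n with _ | n
    · rw [hR0] at ha
      obtain rfl : a = g0 := ha
      left
      rw [zero_add, hM1]
      exact ⟨rfl, hadj⟩
    · by_cases hba : (b, a) ∈ M (n + 1)
      · exact Or.inr ⟨by omega, hba⟩
      · rw [hRi (n + 1) (by omega)] at ha
        left
        rw [hMsucc (n + 1) (by omega)]
        exact ⟨hadj, ha, hba⟩
  induction j generalizing g i with
  | zero => omega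
  | succ j ih =>
    have hj' := hj
    rw [hRi (j + 1) (by omega)] at hj'
    obtain ⟨h, hmsg⟩ := hj'
    obtain ⟨hhj, hadj⟩ := sender_mem j h g hmsg
    rcases send_or_received i g h hi hadj.symm with hsend | ⟨hi1, hrec⟩
    · have hhi := receiver_mem i g h hsend
      rcases lt_trichotomy (i + 1) j with hlt | rfl | hgt
      · have hodd := ih h (i + 1) hlt hhi hhj
        rw [Nat.odd_iff] at hodd ⊢
        omega
      · rw [hMsucc (i + 1) (by omega)] at hmsg
        exact absurd hsend hmsg.2.2
      · obtain rfl : i = j := by omega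
        simp
    · obtain ⟨k, rfl⟩ := Nat.exists_eq_add_of_le' hi1
      have hodd := ih h k (by omega) (sender_mem k h g hrec).1 hhj
      rwa [Nat.add_sub_add_right]
end

section
/- Synchronous flooding on a connected finite simple graph G with initial node g0 always terminates in fewer than 2|G|+1 rounds: R_i = ∅ for all i ≥ 2|G|, where |G| is the number of vertices of G. -/
namespace SimpleGraph

variable {V : Type*} (G : SimpleGraph V)

/-- `G.IsParityDist u n v` says that `n` is the least length of a walk from `v` to `u` among
the walks whose length has the parity of `n`; equivalently, `n` is the distance from `(u, 0)` to
`(v, n mod 2)` in the bipartite double cover of `G`. -/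
def IsParityDist (u : V) (n : ℕ) (v : V) : Prop :=
  (∃ p : G.Walk v u, p.length = n) ∧ ∀ p : G.Walk v u, p.length % 2 = n % 2 → n ≤ p.length

variable {G} {u v w : V} {n m : ℕ}

theorem isParityDist_zero : G.IsParityDist u 0 v ↔ v = u := by
  constructor
  · rintro ⟨⟨p, hp⟩, -⟩
    exact p.eq_of_length_eq_zero hp
  · rintro rfl
    exact ⟨⟨.nil, rfl⟩, fun _ _ => Nat.zero_le _⟩

theorem isParityDist_one_of_adj (h : G.Adj v u) : G.IsParityDist u 1 v :=
  ⟨⟨.cons h .nil, rfl⟩, fun p hp => by omega⟩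

theorem IsParityDist.eq_of_mod_two_eq (hn : G.IsParityDist u n v) (hm : G.IsParityDist u m v)
    (h : n % 2 = m % 2) : n = m := by
  obtain ⟨⟨p, hp⟩, hn⟩ := hn
  obtain ⟨⟨q, hq⟩, hm⟩ := hm
  have := hn q (by omega)
  have := hm p (by omega)
  omega

theorem IsParityDist.exists_adj (h : G.IsParityDist u (n + 1) v) :
    ∃ w, G.Adj w v ∧ G.IsParityDist u n w := by
  obtain ⟨⟨p, hp⟩, hmin⟩ := h
  cases p with
  | nil => simp at hp
  | cons hvw p =>
    refine ⟨_, hvw.symm, ⟨p, by simpa using hp⟩, fun q hq => ?_⟩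
    have := hmin (.cons hvw q) (by rw [Walk.length_cons]; omega)
    rw [Walk.length_cons] at this
    omega

theorem IsParityDist.add_two_iff_of_adj (h : G.IsParityDist u (n + 1) v) (hvw : G.Adj v w) :
    G.IsParityDist u (n + 2) w ↔ ¬ G.IsParityDist u n w := by
  constructor
  · intro h₂ h₀
    have := h₂.eq_of_mod_two_eq h₀ (by omega)
    omega
  · intro h₀
    obtain ⟨⟨p, hp⟩, hmin⟩ := h
    have lower (q : G.Walk w u) (hq : q.length % 2 = n % 2) : n ≤ q.length := by
      have := hmin (.cons hvw q) (by rw [Walk.length_cons]; omega)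
      rw [Walk.length_cons] at this
      omega
    refine ⟨⟨.cons hvw.symm p, by rw [Walk.length_cons, hp]⟩, fun q hq => ?_⟩
    have hne : q.length ≠ n := fun hqn => h₀ ⟨⟨q, hqn⟩, lower⟩
    have := lower q (by omega)
    omega

theorem IsParityDist.exists_of_le (h : G.IsParityDist u n v) (hmn : m ≤ n) :
    ∃ w, G.IsParityDist u m w := by
  induction n, hmn using Nat.le_induction generalizing v with
  | base => exact ⟨v, h⟩
  | succ n _ ih =>
    obtain ⟨w, -, hw⟩ := h.exists_adj
    exact ih hw

theorem IsParityDist.lt_two_mul_card [Fintype V] (h : G.IsParityDist u n v) :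
    n < 2 * Fintype.card V := by
  choose f hf using fun j : Fin (n + 1) => h.exists_of_le (Nat.lt_succ_iff.mp j.isLt)
  have hinj : Function.Injective
      fun j : Fin (n + 1) => ((⟨j % 2, Nat.mod_lt _ two_pos⟩ : Fin 2), f j) := by
    intro j k hjk
    simp only [Prod.mk.injEq, Fin.mk.injEq] at hjk
    exact Fin.ext ((hf j).eq_of_mod_two_eq (hjk.2 ▸ hf k) hjk.1)
  have := Fintype.card_le_of_injective _ hinj
  simp only [Fintype.card_fin, Fintype.card_prod] at this
  omega

theorem mem_flooding_iff {M : ℕ → Set (V × V)}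
    (hM1 : M 1 = {p : V × V | p.1 = u ∧ G.Adj u p.2})
    (hMsucc : ∀ i ≥ 1, M (i + 1) =
      {p : V × V | G.Adj p.1 p.2 ∧ (∃ f, (f, p.1) ∈ M i) ∧ (p.2, p.1) ∉ M i})
    (n : ℕ) (v w : V) :
    (v, w) ∈ M (n + 1) ↔
      G.Adj v w ∧ G.IsParityDist u n v ∧ G.IsParityDist u (n + 1) w := by
  induction n generalizing v w with
  | zero =>
    simp only [zero_add, hM1, Set.mem_ofPred_eq, isParityDist_zero]
    constructor
    · rintro ⟨rfl, h⟩
      exact ⟨h, rfl, isParityDist_one_of_adj h.symm⟩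
    · rintro ⟨h, rfl, -⟩
      exact ⟨rfl, h⟩
  | succ n ih =>
    simp only [hMsucc (n + 1) (by omega), Set.mem_ofPred_eq, ih]
    constructor
    · rintro ⟨h, ⟨f, -, -, hv⟩, hw⟩
      exact ⟨h, hv, (hv.add_two_iff_of_adj h).mpr fun hn => hw ⟨h.symm, hn, hv⟩⟩
    · rintro ⟨h, hv, hw⟩
      obtain ⟨f, hfv, hf⟩ := hv.exists_adj
      exact ⟨h, ⟨f, hfv, hf, hv⟩, fun hn => (hv.add_two_iff_of_adj h).mp hw hn.2.1⟩

end SimpleGraph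

theorem stmt2 {V : Type*} [Fintype V] (G : SimpleGraph V)
    (hconn : G.Connected) (g0 : V)
    (M : ℕ → Set (V × V)) (R : ℕ → Set V)
    (hM1 : M 1 = {p : V × V | p.1 = g0 ∧ G.Adj g0 p.2})
    (hMsucc : ∀ i ≥ 1, M (i + 1) =
      {p : V × V | G.Adj p.1 p.2 ∧ (∃ f, (f, p.1) ∈ M i) ∧ (p.2, p.1) ∉ M i})
    (hR0 : R 0 = {g0})
    (hRi : ∀ i ≥ 1, R i = {h : V | ∃ g, (g, h) ∈ M i}) :
    ∀ i ≥ 2 * Fintype.card V, R i = ∅ := by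
  intro i hi
  have hcard : 0 < Fintype.card V := Fintype.card_pos_iff.mpr ⟨g0⟩
  obtain ⟨n, rfl⟩ : ∃ n, i = n + 1 := ⟨i - 1, by omega⟩
  rw [hRi _ (by omega), Set.eq_empty_iff_forall_notMem]
  rintro h ⟨g, hg⟩
  have := ((SimpleGraph.mem_flooding_iff hM1 hMsucc n g h).mp hg).2.2.lt_two_mul_card
  omega
end

section
/- In synchronous flooding on a connected finite simple graph with initial node g0, for all natural numbers j and all i > j, the distance set D_j is contained in the round-set R_j, and R_j ∩ D_i = ∅; that is, every node at distance j from g0 first receives a message exactly in round j, and no node at distance greater than j receives a message in round j. -/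
/-- In a connected graph, a vertex at positive distance from `u` has a neighbour one step closer. -/
theorem SimpleGraph.Connected.exists_adj_dist_eq {V : Type*} {G : SimpleGraph V}
    (hconn : G.Connected) {u v : V} {n : ℕ} (h : G.dist u v = n + 1) :
    ∃ w, G.Adj w v ∧ G.dist u w = n := by
  obtain ⟨p, hp⟩ := hconn.exists_walk_length_eq_dist v u
  rw [SimpleGraph.dist_comm, h] at hp
  cases p with
  | nil => simp at hp
  | @cons _ w _ hadj q =>
    have hq : q.length = n := by simpa using hp
    have h1 : G.dist w u ≤ n := hq ▸ SimpleGraph.dist_le q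
    have h2 := hconn.dist_triangle (u := u) (v := w) (w := v)
    have h3 : G.dist w v = 1 := SimpleGraph.dist_eq_one_iff_adj.2 hadj.symm
    rw [SimpleGraph.dist_comm] at h1
    exact ⟨w, hadj.symm, by omega⟩

theorem stmt4 {V : Type*} [Fintype V] (G : SimpleGraph V)
    (hconn : G.Connected) (g0 : V)
    (M : ℕ → Set (V × V)) (R : ℕ → Set V)
    (hM1 : M 1 = {p : V × V | p.1 = g0 ∧ G.Adj g0 p.2})
    (hMsucc : ∀ i ≥ 1, M (i + 1) =
      {p : V × V | G.Adj p.1 p.2 ∧ (∃ f, (f, p.1) ∈ M i) ∧ (p.2, p.1) ∉ M i})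
    (hR0 : R 0 = {g0})
    (hRi : ∀ i ≥ 1, R i = {h : V | ∃ g, (g, h) ∈ M i}) :
    ∀ j : ℕ, {g : V | G.dist g0 g = j} ⊆ R j ∧
      ∀ i > j, R j ∩ {g : V | G.dist g0 g = i} = ∅ := by
  have dist_le_succ : ∀ {g h : V}, G.Adj g h → G.dist g0 h ≤ G.dist g0 g + 1 := by
    intro g h hadj
    have := hconn.dist_triangle (u := g0) (v := g) (w := h)
    rwa [SimpleGraph.dist_eq_one_iff_adj.2 hadj] at this
  have sender : ∀ n g h, (g, h) ∈ M (n + 1) → G.Adj g h ∧ G.dist g0 g ≤ n := by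
    intro n
    induction n with
    | zero =>
      intro g h hm
      rw [hM1] at hm
      obtain ⟨rfl, hadj⟩ := hm
      exact ⟨hadj, by simp⟩
    | succ n ih =>
      intro g h hm
      rw [hMsucc (n + 1) (by omega)] at hm
      obtain ⟨hadj, ⟨f, hf⟩, -⟩ := hm
      obtain ⟨hfg, hd⟩ := ih f g hf
      exact ⟨hadj, (dist_le_succ hfg).trans (by omega)⟩
  have receives : ∀ n h, G.dist g0 h = n + 1 → ∃ g, (g, h) ∈ M (n + 1) := by
    intro n
    induction n with
    | zero =>
      intro h hd
      rw [hM1]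
      exact ⟨g0, rfl, SimpleGraph.dist_eq_one_iff_adj.1 hd⟩
    | succ n ih =>
      intro h hd
      obtain ⟨g, hadj, hg⟩ := hconn.exists_adj_dist_eq hd
      rw [hMsucc (n + 1) (by omega)]
      refine ⟨g, hadj, ih g hg, fun hm => ?_⟩
      have := (sender n h g hm).2
      omega
  intro j
  cases j with
  | zero =>
    rw [hR0]
    refine ⟨fun g hg => (hconn.dist_eq_zero_iff.1 hg).symm, fun i hi => ?_⟩
    ext g
    simp only [Set.mem_inter_iff, Set.mem_singleton_iff, Set.mem_ofPred_eq,
      Set.mem_empty_iff_false, iff_false, not_and]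
    rintro rfl
    simp only [SimpleGraph.dist_self]
    omega
  | succ n =>
    rw [hRi (n + 1) (by omega)]
    refine ⟨fun g hg => receives n g hg, fun i hi => ?_⟩
    rw [Set.eq_empty_iff_forall_notMem]
    rintro h ⟨⟨g, hm⟩, hd⟩
    obtain ⟨hadj, hg⟩ := sender n g h hm
    have := dist_le_succ hadj
    rw [Set.mem_ofPred_eq] at hd
    omega
end

section
/- In synchronous flooding on a connected finite simple graph with initial node g0, for every j ∈ ℕ, every node g at distance j from g0, and every neighbour g' of g at distance j+1 from g0, the node g sends a message to g' in round j+1; that is, (g,g') ∈ M_{j+1}. -/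
theorem dist_le_of_mem_flooding {V : Type*} {G : SimpleGraph V}
    (hconn : G.Connected) {g0 : V} {M : ℕ → Set (V × V)}
    (hM1 : M 1 = {p : V × V | p.1 = g0 ∧ G.Adj g0 p.2})
    (hMsucc : ∀ i ≥ 1, M (i + 1) =
      {p : V × V | G.Adj p.1 p.2 ∧ (∃ f, (f, p.1) ∈ M i) ∧ (p.2, p.1) ∉ M i})
    {i : ℕ} {a b : V} (hab : (a, b) ∈ M (i + 1)) :
    G.Adj a b ∧ G.dist g0 a ≤ i := by
  induction i generalizing a b with
  | zero =>
    rw [zero_add, hM1] at hab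
    obtain ⟨rfl, hadj⟩ := hab
    exact ⟨hadj, by simp⟩
  | succ i ih =>
    rw [hMsucc (i + 1) (by omega)] at hab
    obtain ⟨hadj, ⟨f, hf⟩, -⟩ := hab
    obtain ⟨hfa, hdist⟩ := ih hf
    have h := hconn.dist_triangle (u := g0) (v := f) (w := a)
    rw [SimpleGraph.dist_eq_one_iff_adj.mpr hfa] at h
    exact ⟨hadj, by omega⟩

theorem stmt5 {V : Type*} [Fintype V] (G : SimpleGraph V)
    (hconn : G.Connected) (g0 : V)
    (M : ℕ → Set (V × V)) (R : ℕ → Set V)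
    (hM1 : M 1 = {p : V × V | p.1 = g0 ∧ G.Adj g0 p.2})
    (hMsucc : ∀ i ≥ 1, M (i + 1) =
      {p : V × V | G.Adj p.1 p.2 ∧ (∃ f, (f, p.1) ∈ M i) ∧ (p.2, p.1) ∉ M i})
    (hR0 : R 0 = {g0})
    (hRi : ∀ i ≥ 1, R i = {h : V | ∃ g, (g, h) ∈ M i})
    (j : ℕ) (g g' : V) (hg : G.dist g0 g = j) (hg' : G.dist g0 g' = j + 1)
    (hadj : G.Adj g g') :
    (g, g') ∈ M (j + 1) := by
  induction j generalizing g g' with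
  | zero =>
    obtain rfl := hconn.dist_eq_zero_iff.mp hg
    rw [zero_add, hM1]
    exact ⟨rfl, hadj⟩
  | succ j ih =>
    obtain ⟨f, hfg, hf⟩ := hconn.exists_adj_dist_eq hg
    rw [hMsucc (j + 1) (by omega)]
    refine ⟨hadj, ⟨f, ih f g hf hg hfg⟩, fun hback => ?_⟩
    have : G.dist g0 g' ≤ j := (dist_le_of_mem_flooding hconn hM1 hMsucc hback).2
    omega
end

section
/- In synchronous flooding on a connected finite simple graph with initial node g0, if j ≥ 1 and g is an equidistantly-connected node at distance j from g0, then g ∈ R_{j+1}; since also g ∈ R_j, the node g belongs to R_{j+1} for the second time. -/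
namespace Flooding

variable {V : Type*} {G : SimpleGraph V} {g0 : V} {M : ℕ → Set (V × V)}

/-- Messages travel along edges, and the sender of a message in round `i` is at distance less
than `i` from the initial node. -/
lemma adj_and_dist_lt_of_mem
    (hM1 : M 1 = {p : V × V | p.1 = g0 ∧ G.Adj g0 p.2})
    (hMsucc : ∀ i ≥ 1, M (i + 1) =
      {p : V × V | G.Adj p.1 p.2 ∧ (∃ f, (f, p.1) ∈ M i) ∧ (p.2, p.1) ∉ M i})
    (hconn : G.Connected) {i : ℕ} (hi : 1 ≤ i) {a b : V} (hab : (a, b) ∈ M i) :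
    G.Adj a b ∧ G.dist g0 a < i := by
  induction i, hi using Nat.le_induction generalizing a b with
  | base =>
    rw [hM1] at hab
    obtain ⟨rfl, hadj⟩ := hab
    exact ⟨hadj, by simp⟩
  | succ i hi ih =>
    rw [hMsucc i hi] at hab
    obtain ⟨hadj, ⟨f, hf⟩, -⟩ := hab
    obtain ⟨hfa, hlt⟩ := ih hf
    have htri : G.dist g0 a ≤ G.dist g0 f + G.dist f a := hconn.dist_triangle
    rw [SimpleGraph.dist_eq_one_iff_adj.mpr hfa] at htri
    exact ⟨hadj, by lia⟩

/-- A node at distance `i + 1` from `u` has a neighbour at distance `i` from `u`. -/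
lemma exists_adj_dist_eq (hconn : G.Connected) {u v : V} {i : ℕ} (h : G.dist u v = i + 1) :
    ∃ w, G.Adj w v ∧ G.dist u w = i := by
  obtain ⟨p, hp⟩ := hconn.exists_walk_length_eq_dist v u
  rw [SimpleGraph.dist_comm, h] at hp
  cases p with
  | nil => simp at hp
  | @cons _ w _ hadj q =>
    have hq : q.length = i := by simpa using hp
    have hle : G.dist w u ≤ q.length := SimpleGraph.dist_le q
    have htri : G.dist u v ≤ G.dist u w + G.dist w v := hconn.dist_triangle
    rw [SimpleGraph.dist_eq_one_iff_adj.mpr hadj.symm] at htri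
    rw [SimpleGraph.dist_comm] at hle
    exact ⟨w, hadj.symm, by lia⟩

/-- A node at distance `i` from the initial node receives a message in round `i`. -/
lemma exists_mem_of_dist_eq
    (hM1 : M 1 = {p : V × V | p.1 = g0 ∧ G.Adj g0 p.2})
    (hMsucc : ∀ i ≥ 1, M (i + 1) =
      {p : V × V | G.Adj p.1 p.2 ∧ (∃ f, (f, p.1) ∈ M i) ∧ (p.2, p.1) ∉ M i})
    (hconn : G.Connected) {i : ℕ} (hi : 1 ≤ i) {b : V} (hb : G.dist g0 b = i) :
    ∃ a, (a, b) ∈ M i := by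
  induction i, hi using Nat.le_induction generalizing b with
  | base =>
    rw [hM1]
    exact ⟨g0, rfl, SimpleGraph.dist_eq_one_iff_adj.mp hb⟩
  | succ i hi ih =>
    obtain ⟨a, hadj, ha⟩ := exists_adj_dist_eq hconn hb
    rw [hMsucc i hi]
    refine ⟨a, hadj, ih ha, fun hba => ?_⟩
    have hlt := (adj_and_dist_lt_of_mem hM1 hMsucc hconn hi hba).2
    lia

end Flooding


theorem stmt6 {V : Type*} [Fintype V] (G : SimpleGraph V)
    (hconn : G.Connected) (g0 : V)
    (M : ℕ → Set (V × V)) (R : ℕ → Set V)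
    (hM1 : M 1 = {p : V × V | p.1 = g0 ∧ G.Adj g0 p.2})
    (hMsucc : ∀ i ≥ 1, M (i + 1) =
      {p : V × V | G.Adj p.1 p.2 ∧ (∃ f, (f, p.1) ∈ M i) ∧ (p.2, p.1) ∉ M i})
    (hR0 : R 0 = {g0})
    (hRi : ∀ i ≥ 1, R i = {h : V | ∃ g, (g, h) ∈ M i})
    (j : ℕ) (hj : 1 ≤ j) (g : V) (hg : G.dist g0 g = j)
    (hec : ∃ g' : V, g' ≠ g0 ∧ g' ≠ g ∧ G.dist g0 g' = G.dist g0 g ∧ G.Adj g g') :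
    g ∈ R j ∧ g ∈ R (j + 1) := by
  obtain ⟨g', -, -, hdist, hadj⟩ := hec
  rw [hRi j hj, hRi (j + 1) (by lia), hMsucc j hj]
  refine ⟨Flooding.exists_mem_of_dist_eq hM1 hMsucc hconn hj hg, g', hadj.symm,
    Flooding.exists_mem_of_dist_eq hM1 hMsucc hconn hj (hdist.trans hg), fun hmem => ?_⟩
  have hlt := (Flooding.adj_and_dist_lt_of_mem hM1 hMsucc hconn hj hmem).2
  lia
end

section
/- Let G be a connected finite simple graph with initial node g0. Then G has no equidistantly-connected nodes if and only if each node of G is contained in exactly one round-set of the synchronous flooding from g0. -/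
namespace SimpleGraph

variable {V : Type*} {G : SimpleGraph V}

theorem Connected.dist_le_dist_add_one_of_adj (hconn : G.Connected) (u : V) {a b : V}
    (h : G.Adj a b) : G.dist u b ≤ G.dist u a + 1 := by
  have := hconn.dist_triangle (u := u) (v := a) (w := b)
  rwa [dist_eq_one_iff_adj.mpr h] at this

theorem Connected.exists_adj_dist_eq_s7 (hconn : G.Connected) {u a : V} {n : ℕ}
    (h : G.dist u a = n + 1) : ∃ f, G.Adj f a ∧ G.dist u f = n := by
  obtain ⟨p, hp⟩ := hconn.exists_walk_length_eq_dist a u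
  rw [dist_comm, h] at hp
  cases p with
  | nil => simp at hp
  | @cons _ f _ haf q =>
    have hle := dist_le q
    have hstep := hconn.dist_le_dist_add_one_of_adj u haf.symm
    rw [dist_comm] at hle
    rw [Walk.length_cons] at hp
    exact ⟨f, haf.symm, by omega⟩

/-- `M` is the sequence of message sets, from round `1` on, of the amnesiac flooding of `G`
from `g0`. -/
structure IsFlooding (G : SimpleGraph V) (g0 : V) (M : ℕ → Set (V × V)) : Prop where
  one : M 1 = {p : V × V | p.1 = g0 ∧ G.Adj g0 p.2}
  succ : ∀ i ≥ 1, M (i + 1) =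
    {p : V × V | G.Adj p.1 p.2 ∧ (∃ f, (f, p.1) ∈ M i) ∧ (p.2, p.1) ∉ M i}

namespace IsFlooding

variable {g0 : V} {M : ℕ → Set (V × V)}

theorem mem_one_iff (hM : IsFlooding G g0 M) {a b : V} :
    (a, b) ∈ M 1 ↔ a = g0 ∧ G.Adj g0 b := by
  rw [hM.one, Set.mem_ofPred_eq]

theorem mem_succ_iff (hM : IsFlooding G g0 M) {i : ℕ} (hi : 1 ≤ i) {a b : V} :
    (a, b) ∈ M (i + 1) ↔ G.Adj a b ∧ (∃ f, (f, a) ∈ M i) ∧ (b, a) ∉ M i := by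
  rw [hM.succ i hi, Set.mem_ofPred_eq]

theorem adj_and_dist_lt (hM : IsFlooding G g0 M) (hconn : G.Connected) {i : ℕ} (hi : 1 ≤ i)
    {a b : V} (h : (a, b) ∈ M i) : G.Adj a b ∧ G.dist g0 a < i := by
  induction i, hi using Nat.le_induction generalizing a b with
  | base =>
    obtain ⟨rfl, hab⟩ := hM.mem_one_iff.mp h
    exact ⟨hab, by simp⟩
  | succ i hi ih =>
    obtain ⟨hab, ⟨f, hf⟩, -⟩ := (hM.mem_succ_iff hi).mp h
    obtain ⟨hfa, hlt⟩ := ih hf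
    have := hconn.dist_le_dist_add_one_of_adj g0 hfa
    exact ⟨hab, by omega⟩

theorem mem_of_dist_eq (hM : IsFlooding G g0 M) (hconn : G.Connected) {n : ℕ} {a b : V}
    (hab : G.Adj a b) (ha : G.dist g0 a = n) (hb : G.dist g0 b = n + 1) :
    (a, b) ∈ M (n + 1) := by
  induction n generalizing a b with
  | zero =>
    obtain rfl := hconn.dist_eq_zero_iff.mp ha
    exact hM.mem_one_iff.mpr ⟨rfl, hab⟩
  | succ n ih =>
    obtain ⟨f, hfa, hf⟩ := hconn.exists_adj_dist_eq_s7 ha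
    refine (hM.mem_succ_iff (by omega)).mpr ⟨hab, ⟨f, ih hfa hf ha⟩, fun h => ?_⟩
    have := (hM.adj_and_dist_lt hconn (by omega) h).2
    omega

theorem exists_mem_of_dist_eq (hM : IsFlooding G g0 M) (hconn : G.Connected) {n : ℕ} {a : V}
    (ha : G.dist g0 a = n + 1) : ∃ f, (f, a) ∈ M (n + 1) := by
  obtain ⟨f, hfa, hf⟩ := hconn.exists_adj_dist_eq_s7 ha
  exact ⟨f, hM.mem_of_dist_eq hconn hfa hf ha⟩

/-- If no edge joins two nodes equidistant from the initial node, then a message sent in round `i`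
is received at distance `i`. -/
theorem dist_eq_of_mem (hM : IsFlooding G g0 M) (hconn : G.Connected)
    (hne : ∀ a b, G.Adj a b → G.dist g0 b ≠ G.dist g0 a) {i : ℕ} (hi : 1 ≤ i)
    {a b : V} (h : (a, b) ∈ M i) : G.dist g0 b = i := by
  induction i, hi using Nat.le_induction generalizing a b with
  | base => exact dist_eq_one_iff_adj.mpr (hM.mem_one_iff.mp h).2
  | succ i hi ih =>
    obtain ⟨hab, ⟨f, hf⟩, hba⟩ := (hM.mem_succ_iff hi).mp h
    have ha := ih hf
    have hle := hconn.dist_le_dist_add_one_of_adj g0 hab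
    have hle' := hconn.dist_le_dist_add_one_of_adj g0 hab.symm
    have hab_ne := hne a b hab
    by_contra hb
    have hb' : G.dist g0 b + 1 = i := by omega
    subst hb'
    exact hba (hM.mem_of_dist_eq hconn hab.symm rfl ha)

end IsFlooding

end SimpleGraph

theorem stmt7 {V : Type*} [Fintype V] (G : SimpleGraph V)
    (hconn : G.Connected) (g0 : V)
    (M : ℕ → Set (V × V)) (R : ℕ → Set V)
    (hM1 : M 1 = {p : V × V | p.1 = g0 ∧ G.Adj g0 p.2})
    (hMsucc : ∀ i ≥ 1, M (i + 1) =
      {p : V × V | G.Adj p.1 p.2 ∧ (∃ f, (f, p.1) ∈ M i) ∧ (p.2, p.1) ∉ M i})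
    (hR0 : R 0 = {g0})
    (hRi : ∀ i ≥ 1, R i = {h : V | ∃ g, (g, h) ∈ M i}) :
    (∀ g : V, ¬ (∃ g' : V, g' ≠ g0 ∧ g' ≠ g ∧ G.dist g0 g' = G.dist g0 g ∧ G.Adj g g')) ↔ ∀ g : V, ∃! i : ℕ, g ∈ R i := by
  have hM : G.IsFlooding g0 M := ⟨hM1, hMsucc⟩
  have mem_R {i : ℕ} (hi : 1 ≤ i) {h : V} : h ∈ R i ↔ ∃ g, (g, h) ∈ M i := by
    rw [hRi i hi, Set.mem_ofPred_eq]
  have mem_R_dist (g : V) : g ∈ R (G.dist g0 g) := by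
    rcases hd : G.dist g0 g with _ | n
    · rw [hR0, hconn.dist_eq_zero_iff.mp hd]
      rfl
    · exact (mem_R (by omega)).mpr (hM.exists_mem_of_dist_eq hconn hd)
  constructor
  · intro hec g
    have hne (a b : V) (hab : G.Adj a b) : G.dist g0 b ≠ G.dist g0 a := by
      intro heq
      refine hec a ⟨b, ?_, hab.ne', heq, hab⟩
      rintro rfl
      rw [SimpleGraph.dist_self] at heq
      exact hab.ne' (hconn.dist_eq_zero_iff.mp heq.symm)
    refine ⟨_, mem_R_dist g, fun i hi => ?_⟩
    rcases Nat.eq_zero_or_pos i with rfl | hpos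
    · rw [hR0, Set.mem_singleton_iff] at hi
      simp [hi]
    · obtain ⟨f, hf⟩ := (mem_R hpos).mp hi
      exact (hM.dist_eq_of_mem hconn hne hpos hf).symm
  · rintro huniq g ⟨g', hg0, -, heq, hadj⟩
    have hpos : 1 ≤ G.dist g0 g := heq ▸ hconn.pos_dist_of_ne hg0.symm
    have hmem : (g, g') ∈ M (G.dist g0 g + 1) := by
      refine (hM.mem_succ_iff hpos).mpr ⟨hadj, (mem_R hpos).mp (mem_R_dist g), fun h => ?_⟩
      have := (hM.adj_and_dist_lt hconn hpos h).2
      omega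
    have := (huniq g').unique (mem_R_dist g') ((mem_R (by omega)).mpr ⟨g, hmem⟩)
    omega
end

section
/- In synchronous flooding on a connected finite simple graph with initial node g0: if a node h belongs to round-set R_j for the second time (i.e., h ∈ R_j and h ∈ R_i for some i < j), and g is a neighbour of h, then g belongs to some round-set for the second time, and this second occurrence is in R_{j−1}, R_j, or R_{j+1}. -/
/-- `ParityDist G u n v`: some walk from `u` to `v` has length `n`, and no shorter walk from `u`
to `v` has a length of the same parity. -/
def ParityDist {V : Type*} (G : SimpleGraph V) (u : V) (n : ℕ) (v : V) : Prop :=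
  (∃ w : G.Walk u v, w.length = n) ∧ ∀ w : G.Walk u v, w.length % 2 = n % 2 → n ≤ w.length

namespace ParityDist

variable {V : Type*} {G : SimpleGraph V} {u v w : V} {m n : ℕ}

lemma eq_of_mod_two_eq (hm : ParityDist G u m v) (hn : ParityDist G u n v)
    (h : m % 2 = n % 2) : m = n := by
  obtain ⟨⟨p, rfl⟩, hp⟩ := hm
  obtain ⟨⟨q, rfl⟩, hq⟩ := hn
  exact le_antisymm (hp q h.symm) (hq p h)

lemma exists_of_walk (p : G.Walk u v) :
    ∃ k ≤ p.length, k % 2 = p.length % 2 ∧ ParityDist G u k v := by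
  classical
  have hex : ∃ k, k % 2 = p.length % 2 ∧ ∃ q : G.Walk u v, q.length = k := ⟨_, rfl, p, rfl⟩
  obtain ⟨hk, hq⟩ := Nat.find_spec hex
  exact ⟨Nat.find hex, Nat.find_min' hex ⟨rfl, p, rfl⟩, hk, hq, fun q hq' =>
    Nat.find_min' hex ⟨hq'.trans hk, q, rfl⟩⟩

lemma zero_iff : ParityDist G u 0 v ↔ v = u := by
  constructor
  · rintro ⟨⟨p, hp⟩, -⟩
    exact (SimpleGraph.Walk.eq_of_length_eq_zero hp).symm
  · rintro rfl
    exact ⟨⟨.nil, rfl⟩, fun _ _ => Nat.zero_le _⟩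

/-- A neighbour of a vertex at parity distance `n` has a parity distance of the other parity, at
most `n + 1`. -/
lemma exists_of_adj (h : ParityDist G u n v) (hadj : G.Adj v w) :
    ∃ k ≤ n + 1, k % 2 = (n + 1) % 2 ∧ ParityDist G u k w := by
  obtain ⟨⟨p, rfl⟩, -⟩ := h
  simpa using exists_of_walk (p.concat hadj)

lemma le_succ_of_adj (hm : ParityDist G u m v) (hn : ParityDist G u n w) (hadj : G.Adj v w)
    (hpar : n % 2 = (m + 1) % 2) : n ≤ m + 1 := by
  obtain ⟨k, hk, hkpar, hkw⟩ := hm.exists_of_adj hadj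
  rwa [hn.eq_of_mod_two_eq hkw (hpar.trans hkpar.symm)]

lemma exists_pred (h : ParityDist G u (n + 1) v) :
    ∃ w, G.Adj w v ∧ ParityDist G u n w := by
  obtain ⟨p, hp⟩ := h.1
  have hnil : ¬ p.Nil := by
    rw [SimpleGraph.Walk.not_nil_iff_lt_length]
    omega
  have hadj := p.adj_penultimate hnil
  have hlen : p.dropLast.length = n := by
    have := SimpleGraph.Walk.length_dropLast_add_one hnil
    omega
  obtain ⟨k, hk, hkpar, hkw⟩ := exists_of_walk p.dropLast
  have := hkw.le_succ_of_adj h hadj (by omega)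
  obtain rfl : k = n := by omega
  exact ⟨_, hadj, hkw⟩

/-- Extending by an edge increases the parity distance unless the edge was just traversed
backwards. -/
lemma succ_or_pred (h : ParityDist G u (n + 1) v) (hadj : G.Adj v w) :
    ParityDist G u (n + 2) w ∨ ParityDist G u n w := by
  obtain ⟨k, hk, hkpar, hkw⟩ := h.exists_of_adj hadj
  have := hkw.le_succ_of_adj h hadj.symm (by omega)
  obtain rfl | rfl : k = n + 2 ∨ k = n := by omega
  · exact Or.inl hkw
  · exact Or.inr hkw

/-- If `v` has the two parity distances `m < n`, then so does each neighbour `w` of `v`, and the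
larger one differs by at most one from `n`. -/
lemma exists_second_of_adj (hm : ParityDist G u m v) (hn : ParityDist G u n v) (hmn : m < n)
    (hadj : G.Adj v w) :
    ∃ k, ParityDist G u k w ∧ (∃ i < k, ParityDist G u i w) ∧
      (k = n - 1 ∨ k = n ∨ k = n + 1) := by
  have hpar : m % 2 ≠ n % 2 := fun h => hmn.ne (hm.eq_of_mod_two_eq hn h)
  obtain ⟨a, ha, hapar, haw⟩ := hm.exists_of_adj hadj
  obtain ⟨b, hb, hbpar, hbw⟩ := hn.exists_of_adj hadj
  have := hbw.le_succ_of_adj hn hadj.symm (by omega)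
  rcases lt_or_ge a b with hab | hab
  · exact ⟨b, hbw, ⟨a, hab, haw⟩, by omega⟩
  · exact ⟨a, haw, ⟨b, by omega, hbw⟩, by omega⟩

end ParityDist

/-- In round `n + 1` of flooding, messages travel along the edges whose ends have parity distances
`n` and `n + 1`. -/
lemma mem_flooding_iff {V : Type*} {G : SimpleGraph V} {u : V} {M : ℕ → Set (V × V)}
    (hM1 : M 1 = {p : V × V | p.1 = u ∧ G.Adj u p.2})
    (hMsucc : ∀ i ≥ 1, M (i + 1) =
      {p : V × V | G.Adj p.1 p.2 ∧ (∃ f, (f, p.1) ∈ M i) ∧ (p.2, p.1) ∉ M i})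
    (n : ℕ) (v w : V) :
    (v, w) ∈ M (n + 1) ↔ G.Adj v w ∧ ParityDist G u n v ∧ ParityDist G u (n + 1) w := by
  induction n generalizing v w with
  | zero =>
    simp only [hM1, Set.mem_ofPred_eq, ParityDist.zero_iff]
    constructor
    · rintro ⟨rfl, hadj⟩
      exact ⟨hadj, rfl, ⟨hadj.toWalk, rfl⟩, fun _ _ => by omega⟩
    · rintro ⟨hadj, rfl, -⟩
      exact ⟨rfl, hadj⟩
  | succ n ih =>
    simp only [hMsucc (n + 1) (by omega), Set.mem_ofPred_eq, ih]
    constructor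
    · rintro ⟨hadj, ⟨f, -, -, hv⟩, hback⟩
      exact ⟨hadj, hv, (hv.succ_or_pred hadj).resolve_right fun hw => hback ⟨hadj.symm, hw, hv⟩⟩
    · rintro ⟨hadj, hv, hw⟩
      obtain ⟨f, hf, hfn⟩ := hv.exists_pred
      refine ⟨hadj, ⟨f, hf, hfn, hv⟩, fun ⟨_, hw', _⟩ => ?_⟩
      have := hw'.eq_of_mod_two_eq hw (by omega)
      omega


theorem stmt10 {V : Type*} [Fintype V] (G : SimpleGraph V)
    (hconn : G.Connected) (g0 : V)
    (M : ℕ → Set (V × V)) (R : ℕ → Set V)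
    (hM1 : M 1 = {p : V × V | p.1 = g0 ∧ G.Adj g0 p.2})
    (hMsucc : ∀ i ≥ 1, M (i + 1) =
      {p : V × V | G.Adj p.1 p.2 ∧ (∃ f, (f, p.1) ∈ M i) ∧ (p.2, p.1) ∉ M i})
    (hR0 : R 0 = {g0})
    (hRi : ∀ i ≥ 1, R i = {h : V | ∃ g, (g, h) ∈ M i})
    (h : V) (j : ℕ) (hj : h ∈ R j) (hj2 : ∃ i < j, h ∈ R i)
    (g : V) (hadj : G.Adj g h) :
    ∃ k : ℕ, g ∈ R k ∧ (∃ i < k, g ∈ R i) ∧ (k = j - 1 ∨ k = j ∨ k = j + 1) := by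
  have hR : ∀ n v, v ∈ R n ↔ ParityDist G g0 n v := by
    rintro (_ | n) v
    · rw [hR0, Set.mem_singleton_iff, ParityDist.zero_iff]
    · simp only [hRi (n + 1) (by omega), Set.mem_ofPred_eq, mem_flooding_iff hM1 hMsucc]
      exact ⟨fun ⟨_, _, _, hv⟩ => hv, fun hv =>
        let ⟨f, hf, hfn⟩ := hv.exists_pred
        ⟨f, hf, hfn, hv⟩⟩
  simp only [hR] at hj hj2 ⊢
  obtain ⟨i, hij, hi⟩ := hj2
  exact hi.exists_second_of_adj hj hij hadj.symm
end

section
/- Let G be the cycle graph C_n with n even, n ≥ 4, and let g0 be any node of G, which has eccentricity e = n/2. Then synchronous flooding from g0 terminates after round e: R_e ≠ ∅ and R_i = ∅ for all i > e. -/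
/-- Adjacency in a cycle graph, read off from the offsets of the two nodes from a base node. -/
theorem cycleGraph_adj_iff_offset {n : ℕ} (hn : 2 ≤ n) (g0 u v : Fin n) :
    (SimpleGraph.cycleGraph n).Adj u v ↔
      (u - g0).val + 1 = (v - g0).val ∨ (v - g0).val + 1 = (u - g0).val ∨
      ((u - g0).val = 0 ∧ (v - g0).val + 1 = n) ∨
      ((v - g0).val = 0 ∧ (u - g0).val + 1 = n) := by
  obtain ⟨k, rfl⟩ : ∃ k, n = k + 2 := ⟨n - 2, by omega⟩
  have val_sub_eq_one (x y : Fin (k + 2)) :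
      (x - y).val = 1 ↔ y.val + 1 = x.val ∨ (x.val = 0 ∧ y.val + 1 = k + 2) := by
    rcases le_or_gt y x with h | h
    · rw [Fin.sub_val_of_le h]
      have := Fin.le_def.1 h
      omega
    · rw [Fin.val_sub, Nat.mod_eq_of_lt (by have := Fin.lt_def.1 h; omega)]
      have := Fin.lt_def.1 h
      omega
  rw [SimpleGraph.cycleGraph_adj', ← sub_sub_sub_cancel_right u v g0,
    ← sub_sub_sub_cancel_right v u g0, val_sub_eq_one, val_sub_eq_one]
  omega

theorem Fin.exists_val_sub_eq {n k : ℕ} (hk : k < n) (g0 : Fin n) :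
    ∃ v : Fin n, (v - g0).val = k := by
  have : NeZero n := ⟨by omega⟩
  exact ⟨⟨k, hk⟩ + g0, by rw [add_sub_cancel_right]⟩

/-- Up to the eccentricity of the initial node, flooding on an even cycle sends exactly two
messages per round, one along each of the two arcs leaving the initial node. -/
theorem mem_flooding_cycleGraph_iff {m : ℕ} (hm : 2 ≤ m) (g0 : Fin (m + m))
    (M : ℕ → Set (Fin (m + m) × Fin (m + m)))
    (hM1 : M 1 = {p | p.1 = g0 ∧ (SimpleGraph.cycleGraph (m + m)).Adj g0 p.2})
    (hMsucc : ∀ i ≥ 1, M (i + 1) =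
      {p | (SimpleGraph.cycleGraph (m + m)).Adj p.1 p.2 ∧
        (∃ f, (f, p.1) ∈ M i) ∧ (p.2, p.1) ∉ M i})
    {i : ℕ} (hi : 1 ≤ i) (him : i ≤ m) (g h : Fin (m + m)) :
    (g, h) ∈ M i ↔
      ((g - g0).val + 1 = i ∧ (h - g0).val = i) ∨
      (((g - g0).val + i = m + m + 1 ∨ (i = 1 ∧ (g - g0).val = 0)) ∧
        (h - g0).val + i = m + m) := by
  have : NeZero (m + m) := ⟨by omega⟩
  induction i, hi using Nat.le_induction generalizing g h with
  | base =>
    have hg : g = g0 ↔ (g - g0).val = 0 := by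
      rw [← sub_eq_zero, Fin.ext_iff, Fin.val_zero]
    have hg0 : (g0 - g0).val = 0 := by simp
    rw [hM1, Set.mem_ofPred_eq, cycleGraph_adj_iff_offset (by omega) g0]
    dsimp only
    rw [hg, hg0]
    have := (g - g0).isLt
    omega
  | succ i hi ih =>
    have ih := ih (by omega)
    have hex : (∃ f, (f, g) ∈ M i) ↔ (g - g0).val = i ∨ (g - g0).val + i = m + m := by
      constructor
      · rintro ⟨f, hf⟩
        have := (ih f g).1 hf
        omega
      · rintro (hg | hg)
        · obtain ⟨f, hf⟩ := Fin.exists_val_sub_eq (k := i - 1) (by omega) g0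
          exact ⟨f, (ih f g).2 (by omega)⟩
        · rcases eq_or_lt_of_le hi with rfl | hi'
          · exact ⟨g0, (ih g0 g).2 (Or.inr ⟨Or.inr ⟨rfl, by simp⟩, hg⟩)⟩
          · obtain ⟨f, hf⟩ := Fin.exists_val_sub_eq (k := m + m + 1 - i) (by omega) g0
            exact ⟨f, (ih f g).2 (by omega)⟩
    rw [hMsucc i hi, Set.mem_ofPred_eq, cycleGraph_adj_iff_offset (by omega) g0]
    dsimp only
    rw [hex, propext (ih h g)]
    have := (g - g0).isLt
    have := (h - g0).isLt
    omega

theorem stmt13 (n : ℕ) (hn : 4 ≤ n) (hpar : Even n) (g0 : Fin n)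
    (M : ℕ → Set (Fin n × Fin n)) (R : ℕ → Set (Fin n))
    (hM1 : M 1 = {p : Fin n × Fin n | p.1 = g0 ∧ (SimpleGraph.cycleGraph n).Adj g0 p.2})
    (hMsucc : ∀ i ≥ 1, M (i + 1) =
      {p : Fin n × Fin n | (SimpleGraph.cycleGraph n).Adj p.1 p.2 ∧
        (∃ f, (f, p.1) ∈ M i) ∧ (p.2, p.1) ∉ M i})
    (hR0 : R 0 = {g0})
    (hRi : ∀ i ≥ 1, R i = {h : Fin n | ∃ g, (g, h) ∈ M i}) :
    R (n / 2) ≠ ∅ ∧ ∀ i > (n / 2), R i = ∅ := by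
  obtain ⟨m, rfl⟩ := hpar
  have hm : 2 ≤ m := by omega
  rw [show (m + m) / 2 = m by omega]
  have key := mem_flooding_cycleGraph_iff hm g0 M hM1 hMsucc (i := m) (by omega) le_rfl
  refine ⟨?_, fun i hi => ?_⟩
  · obtain ⟨g, hg⟩ := Fin.exists_val_sub_eq (k := m - 1) (by omega) g0
    obtain ⟨h, hh⟩ := Fin.exists_val_sub_eq (k := m) (by omega) g0
    rw [hRi m (by omega)]
    exact Set.Nonempty.ne_empty ⟨h, g, (key g h).2 (by omega)⟩
  · have hMempty : M i = ∅ := by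
      induction i, Nat.succ_le_of_lt hi using Nat.le_induction with
      | base =>
        rw [Nat.succ_eq_add_one, hMsucc m (by omega), Set.eq_empty_iff_forall_notMem]
        rintro ⟨g, h⟩ ⟨hadj, ⟨f, hf⟩, hback⟩
        rw [cycleGraph_adj_iff_offset (by omega) g0] at hadj
        rw [key] at hf hback
        omega
      | succ i hi' ih =>
        rw [hMsucc i (by omega), ih (by omega)]
        simp
    rw [hRi i (by omega), hMempty]
    simp
end

section
/- Let G be the cycle graph C_n with n odd, n ≥ 3, and let g0 be any node of G, which has eccentricity e = (n−1)/2. Then synchronous flooding from g0 terminates after round 2e+1 = n: R_n ≠ ∅ and R_i = ∅ for all i > n. -/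
/-- Two messages travelling in opposite directions around a cycle, with receivers `x ≠ y`, both
advance by one step. -/
theorem flooding_step {A : Type*} [CommRing A] (h2 : (2 : A) ≠ 0) {x y : A} (hxy : x ≠ y) :
    {p : A × A | (p.1 - p.2 = 1 ∨ p.2 - p.1 = 1) ∧
      (∃ f, (f, p.1) ∈ ({(x - 1, x), (y + 1, y)} : Set (A × A))) ∧
      (p.2, p.1) ∉ ({(x - 1, x), (y + 1, y)} : Set (A × A))} =
    {(x, x + 1), (y, y - 1)} := by
  ext ⟨a, b⟩
  simp only [Set.mem_ofPred_eq, Set.mem_insert_iff, Set.mem_singleton_iff, Prod.mk.injEq, not_or]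
  constructor
  · rintro ⟨hab, ⟨f, hf⟩, h3, h4⟩
    grind
  · rintro (⟨rfl, rfl⟩ | ⟨rfl, rfl⟩)
    · refine ⟨.inr (by ring), ⟨_, .inl ⟨rfl, rfl⟩⟩, fun h => h2 ?_, fun h => hxy h.2⟩
      linear_combination h.1
    · refine ⟨.inl (by ring), ⟨_, .inr ⟨rfl, rfl⟩⟩, fun h => hxy h.2.symm, fun h => h2 ?_⟩
      linear_combination -h.1

/-- When both messages reach the same node, that node has no neighbour left to send to. -/
theorem flooding_last {A : Type*} [CommRing A] (x : A) :
    {p : A × A | (p.1 - p.2 = 1 ∨ p.2 - p.1 = 1) ∧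
      (∃ f, (f, p.1) ∈ ({(x - 1, x), (x + 1, x)} : Set (A × A))) ∧
      (p.2, p.1) ∉ ({(x - 1, x), (x + 1, x)} : Set (A × A))} = ∅ := by
  ext ⟨a, b⟩
  simp only [Set.mem_ofPred_eq, Set.mem_insert_iff, Set.mem_singleton_iff, Prod.mk.injEq, not_or,
    Set.mem_empty_iff_false, iff_false]
  rintro ⟨hab, ⟨f, hf⟩, h3, h4⟩
  grind

theorem flooding_zmod {n : ℕ} (hn : 3 ≤ n) (hpar : Odd n) (g0 : ZMod n)
    (M : ℕ → Set (ZMod n × ZMod n))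
    (hM1 : M 1 = {p | p.1 = g0 ∧ (g0 - p.2 = 1 ∨ p.2 - g0 = 1)})
    (hMsucc : ∀ i ≥ 1, M (i + 1) =
      {p | (p.1 - p.2 = 1 ∨ p.2 - p.1 = 1) ∧ (∃ f, (f, p.1) ∈ M i) ∧ (p.2, p.1) ∉ M i}) :
    (g0 - 1, g0) ∈ M n ∧ ∀ i > n, M i = ∅ := by
  have two_mul_ne : ∀ i : ℕ, 1 ≤ i → i < n → (2 * i : ZMod n) ≠ 0 := by
    intro i h1 h2 h
    have hdvd : n ∣ 2 * i := (ZMod.natCast_eq_zero_iff _ _).1 (by push_cast; exact h)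
    have := Nat.le_of_dvd h1 ((Nat.coprime_two_right.2 hpar).dvd_of_dvd_mul_left hdvd)
    omega
  have h2 : (2 : ZMod n) ≠ 0 := by simpa using two_mul_ne 1 le_rfl (by omega)
  have hM : ∀ i ≥ 1, i ≤ n → M i = {(g0 + i - 1, g0 + i), (g0 - i + 1, g0 - i)} := by
    intro i hi
    induction i, hi using Nat.le_induction with
    | base =>
      intro _
      rw [hM1]
      ext ⟨a, b⟩
      simp only [Set.mem_ofPred_eq, Set.mem_insert_iff, Set.mem_singleton_iff, Prod.mk.injEq,
        Nat.cast_one]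
      grind
    | succ i hi ih =>
      intro hin
      have hne : g0 + i ≠ g0 - (i : ZMod n) := fun h =>
        two_mul_ne i hi (by omega) (by linear_combination h)
      rw [hMsucc i hi, ih (by omega), flooding_step h2 hne]
      push_cast
      rw [← add_assoc, add_sub_cancel_right, sub_add_eq_sub_sub, sub_add_cancel]
  have hMn : M n = {(g0 - 1, g0), (g0 + 1, g0)} := by
    simpa using hM n (by omega) le_rfl
  refine ⟨by simp [hMn], fun i hi => ?_⟩
  induction i, (hi : n + 1 ≤ i) using Nat.le_induction with
  | base => rw [hMsucc n (by omega), hMn, flooding_last]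
  | succ i hi ih => simp [hMsucc i (by omega), ih]

theorem stmt14 (n : ℕ) (hn : 3 ≤ n) (hpar : Odd n) (g0 : Fin n)
    (M : ℕ → Set (Fin n × Fin n)) (R : ℕ → Set (Fin n))
    (hM1 : M 1 = {p : Fin n × Fin n | p.1 = g0 ∧ (SimpleGraph.cycleGraph n).Adj g0 p.2})
    (hMsucc : ∀ i ≥ 1, M (i + 1) =
      {p : Fin n × Fin n | (SimpleGraph.cycleGraph n).Adj p.1 p.2 ∧
        (∃ f, (f, p.1) ∈ M i) ∧ (p.2, p.1) ∉ M i})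
    (hR0 : R 0 = {g0})
    (hRi : ∀ i ≥ 1, R i = {h : Fin n | ∃ g, (g, h) ∈ M i}) :
    R n ≠ ∅ ∧ ∀ i > n, R i = ∅ := by
  obtain ⟨k, rfl⟩ : ∃ k, n = k + 2 := ⟨n - 2, by omega⟩
  simp only [SimpleGraph.cycleGraph_adj] at hM1 hMsucc
  obtain ⟨hmem, hempty⟩ := flooding_zmod hn hpar g0 M hM1 hMsucc
  refine ⟨?_, fun i hi => ?_⟩
  · rw [hRi _ (by omega)]
    exact Set.Nonempty.ne_empty ⟨g0, _, hmem⟩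
  · rw [hRi i (by omega)]
    ext h
    have hi_empty : M i = ∅ := hempty i hi
    simp [hi_empty]
end
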